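/- The partial sums T_n = Σ_{k=1}^n X_k satisfy: (i) the strong law of large numbers, T_n / n → p − q almost surely as n → ∞; (ii) the central limit theorem, (T_n − n(p−q)) / √(n(p + q − (p−q)²)) converges in distribution to the standard normal law N(0,1); and (iii) the law of the iterated logarithm, limsup_{n→∞} (T_n − n(p−q)) / √(2 n log log n) = √(p + q − (p−q)²) and liminf_{n→∞} (T_n − n(p−q)) / √(2 n log log n) = −√(p + q − (p−q)²) almost surely. -/

import Mathlib

open MeasureTheory ProbabilityTheory Filter Real
open scoped ENNReal NNReal Topology Classical

noncomputable section

/-- The σ-algebra `σ(X_1, …, X_n)` generated by the first `n` steps. -/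
def sigmaUpTo {Ω : Type*} (X : ℕ → Ω → ℝ) (n : ℕ) : MeasurableSpace Ω :=
  MeasurableSpace.comap (fun ω (k : Fin n) => X ((k : ℕ) + 1) ω) inferInstance

/-- Weak convergence of a sequence of measures on `ℝ` (convergence in distribution):
integrals of every bounded continuous function converge. -/
def TendstoInDist (μs : ℕ → Measure ℝ) (ν : Measure ℝ) : Prop :=
  ∀ f : BoundedContinuousFunction ℝ ℝ,
    Tendsto (fun n => ∫ x, f x ∂(μs n)) atTop (𝓝 (∫ x, f x ∂ν))

/-- The weight a set `A` gets under the step law. -/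
def stepProb (p q : ℝ) (A : Set ℝ) : ℝ :=
  A.indicator (fun _ => (1 : ℝ)) 0
    + (A.indicator (fun _ => (1 : ℝ)) 1 - A.indicator (fun _ => (1 : ℝ)) 0) * p
    + (A.indicator (fun _ => (1 : ℝ)) (-1) - A.indicator (fun _ => (1 : ℝ)) 0) * q

lemma sigmaUpTo_le {Ω : Type*} [mΩ : MeasurableSpace Ω] (X : ℕ → Ω → ℝ)
    (hXmeas : ∀ n, Measurable (X n)) (n : ℕ) : sigmaUpTo X n ≤ mΩ := by
  apply Measurable.comap_le
  exact measurable_pi_lambda _ fun k => hXmeas _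

lemma measurable_sigmaUpTo {Ω : Type*} (X : ℕ → Ω → ℝ) (n k : ℕ) (hk : k < n) :
    Measurable[sigmaUpTo X n] (X (k + 1)) := by
  have h : Measurable[sigmaUpTo X n] (fun ω (k : Fin n) => X ((k : ℕ) + 1) ω) :=
    comap_measurable _
  exact (measurable_pi_apply (⟨k, hk⟩ : Fin n)).comp h

lemma step_indep {Ω : Type*} [mΩ : MeasurableSpace Ω] (P : Measure Ω) [IsProbabilityMeasure P]
    (p q : ℝ) (X : ℕ → Ω → ℝ) (hXmeas : ∀ n, Measurable (X n))
    (hXval : ∀ n, 1 ≤ n → ∀ ω, X n ω = 1 ∨ X n ω = -1 ∨ X n ω = 0)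
    (hcondp : ∀ n : ℕ, 1 ≤ n →
      P[Set.indicator {ω | X (n + 1) ω = 1} (fun _ => (1 : ℝ)) | sigmaUpTo X n]
        =ᵐ[P] fun _ => p)
    (hcondq : ∀ n : ℕ, 1 ≤ n →
      P[Set.indicator {ω | X (n + 1) ω = -1} (fun _ => (1 : ℝ)) | sigmaUpTo X n]
        =ᵐ[P] fun _ => q)
    (n : ℕ) (hn : 1 ≤ n) (A : Set ℝ) (hA : MeasurableSet A) (B : Set Ω)
    (hB : MeasurableSet[sigmaUpTo X n] B) :
    P.real (X (n + 1) ⁻¹' A ∩ B) = stepProb p q A * P.real B := by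
  have hle := sigmaUpTo_le X hXmeas n
  have hBm : MeasurableSet B := hle _ hB
  have m1 : MeasurableSet {ω | X (n + 1) ω = 1} := hXmeas _ (measurableSet_singleton 1)
  have m2 : MeasurableSet {ω | X (n + 1) ω = -1} := hXmeas _ (measurableSet_singleton (-1))
  have i1 : Integrable (Set.indicator {ω | X (n + 1) ω = 1} (fun _ => (1 : ℝ))) P :=
    (integrable_const 1).indicator m1
  have i2 : Integrable (Set.indicator {ω | X (n + 1) ω = -1} (fun _ => (1 : ℝ))) P :=
    (integrable_const 1).indicator m2
  have e1 : ∫ ω in B, Set.indicator {ω | X (n + 1) ω = 1} (fun _ => (1 : ℝ)) ω ∂P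
      = p * P.real B := by
    rw [← setIntegral_condExp hle i1 hB,
      setIntegral_congr_ae (g := fun _ => p) hBm (by filter_upwards [hcondp n hn] with ω h _ using h)]
    simp [mul_comm]
  have e2 : ∫ ω in B, Set.indicator {ω | X (n + 1) ω = -1} (fun _ => (1 : ℝ)) ω ∂P
      = q * P.real B := by
    rw [← setIntegral_condExp hle i2 hB,
      setIntegral_congr_ae (g := fun _ => q) hBm (by filter_upwards [hcondq n hn] with ω h _ using h)]
    simp [mul_comm]
  have hXA : MeasurableSet (X (n + 1) ⁻¹' A) := hXmeas _ hA
  have e3 : P.real (X (n + 1) ⁻¹' A ∩ B)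
      = ∫ ω in B, Set.indicator (X (n + 1) ⁻¹' A) (fun _ => (1 : ℝ)) ω ∂P := by
    rw [integral_indicator_const _ hXA]
    simp [measureReal_restrict_apply hXA]
  have e4 : ∀ ω, Set.indicator (X (n + 1) ⁻¹' A) (fun _ => (1 : ℝ)) ω
      = A.indicator (fun _ => (1 : ℝ)) 0
    + (A.indicator (fun _ => (1 : ℝ)) 1 - A.indicator (fun _ => (1 : ℝ)) 0) *
        Set.indicator {ω | X (n + 1) ω = 1} (fun _ => (1 : ℝ)) ω
    + (A.indicator (fun _ => (1 : ℝ)) (-1) - A.indicator (fun _ => (1 : ℝ)) 0) *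
        Set.indicator {ω | X (n + 1) ω = -1} (fun _ => (1 : ℝ)) ω := by
    intro ω
    rcases hXval (n + 1) (by omega) ω with h | h | h <;>
      simp [Set.indicator_apply, h] <;> norm_num
  rw [e3]
  simp_rw [e4]
  rw [integral_add, integral_add, integral_const_mul, integral_const_mul, e1, e2]
  · simp [stepProb]; ring
  · exact integrable_const _
  · exact (i1.const_mul _).integrableOn
  · exact (integrable_const _).add (i1.const_mul _).integrableOn
  · exact (i2.const_mul _).integrableOn

lemma steps_iIndepFun {Ω : Type*} [mΩ : MeasurableSpace Ω] (P : Measure Ω) [IsProbabilityMeasure P]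
    (p q : ℝ) (X : ℕ → Ω → ℝ) (hXmeas : ∀ n, Measurable (X n))
    (hXval : ∀ n, 1 ≤ n → ∀ ω, X n ω = 1 ∨ X n ω = -1 ∨ X n ω = 0)
    (hcondp : ∀ n : ℕ, 1 ≤ n →
      P[Set.indicator {ω | X (n + 1) ω = 1} (fun _ => (1 : ℝ)) | sigmaUpTo X n]
        =ᵐ[P] fun _ => p)
    (hcondq : ∀ n : ℕ, 1 ≤ n →
      P[Set.indicator {ω | X (n + 1) ω = -1} (fun _ => (1 : ℝ)) | sigmaUpTo X n]
        =ᵐ[P] fun _ => q) :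
    (∀ n A, MeasurableSet A → P.real (X (n + 2) ⁻¹' A) = stepProb p q A) ∧
    iIndepFun (fun n => X (n + 2)) P := by
  have h1 : ∀ n A, MeasurableSet A → P.real (X (n + 2) ⁻¹' A) = stepProb p q A := by
    intro n A hA
    have := step_indep P p q X hXmeas hXval hcondp hcondq (n + 1) (by omega) A hA Set.univ
      MeasurableSet.univ
    simpa using this
  refine ⟨h1, ?_⟩
  have h2 : ∀ n (A : ℕ → Set ℝ), (∀ k, MeasurableSet (A k)) →
      P (⋂ k ∈ Finset.range n, X (k + 2) ⁻¹' (A k))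
        = ∏ k ∈ Finset.range n, P (X (k + 2) ⁻¹' (A k)) := by
    intro n A hA
    induction n with
    | zero => simp
    | succ n ih =>
      rw [Finset.prod_range_succ, ← ih, Finset.range_add_one, Finset.set_biInter_insert]
      have hB : MeasurableSet[sigmaUpTo X (n + 1)] (⋂ k ∈ Finset.range n, X (k + 2) ⁻¹' (A k)) := by
        refine Finset.measurableSet_biInter _ fun k hk => ?_
        exact measurable_sigmaUpTo X (n + 1) (k + 1) (by simpa using hk) (hA k)
      have := step_indep P p q X hXmeas hXval hcondp hcondq (n + 1) (by omega) (A n) (hA n) _ hB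
      rw [← h1 n _ (hA n)] at this
      rw [← ENNReal.toReal_eq_toReal_iff' (measure_ne_top _ _)
        (ENNReal.mul_ne_top (measure_ne_top _ _) (measure_ne_top _ _)), ENNReal.toReal_mul]
      rw [mul_comm]
      exact this
  rw [iIndepFun_iff_measure_inter_preimage_eq_mul]
  intro S A hA
  obtain ⟨N, hN⟩ : ∃ N, S ⊆ Finset.range N := S.exists_nat_subset_range
  have := h2 N (fun k => if k ∈ S then A k else Set.univ) (by
    intro k; by_cases h : k ∈ S
    · simpa [h] using hA k h
    · simp [h])
  have e1 : (⋂ k ∈ Finset.range N, X (k + 2) ⁻¹' (if k ∈ S then A k else Set.univ))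
      = ⋂ k ∈ S, X (k + 2) ⁻¹' (A k) := by
    ext ω
    simp only [Set.mem_iInter, Set.mem_preimage]
    constructor
    · intro h k hk
      simpa [hk] using h k (hN hk)
    · intro h k hk
      by_cases hkS : k ∈ S
      · simpa [hkS] using h k hkS
      · simp [hkS]
  rw [e1] at this
  rw [this, ← Finset.prod_subset hN]
  · refine Finset.prod_congr rfl fun k hk => by simp [hk]
  · intro k _ hk
    simp [hk]

/-- Bounded standardized i.i.d. sequence. -/
structure StdSeq {Ω : Type*} [MeasurableSpace Ω] (P : Measure Ω) (Z : ℕ → Ω → ℝ) (B : ℝ) :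
    Prop where
  meas : ∀ n, Measurable (Z n)
  indep : iIndepFun Z P
  ident : ∀ n, IdentDistrib (Z n) (Z 0) P P
  bpos : 0 < B
  bdd : ∀ n ω, |Z n ω| ≤ B
  mean : ∫ ω, Z 0 ω ∂P = 0
  sq : ∫ ω, (Z 0 ω) ^ 2 ∂P = 1

/-- Partial sums. -/
def pSum {Ω : Type*} (Z : ℕ → Ω → ℝ) (n : ℕ) (ω : Ω) : ℝ := ∑ k ∈ Finset.range n, Z k ω

section Std

variable {Ω : Type*} [mΩ : MeasurableSpace Ω] {P : Measure Ω} [IsProbabilityMeasure P]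
  {Z : ℕ → Ω → ℝ} {B : ℝ}

lemma StdSeq.neg (h : StdSeq P Z B) : StdSeq P (fun n ω => - Z n ω) B where
  meas n := (h.meas n).neg
  indep := h.indep.comp (fun _ x => -x) (fun _ => measurable_neg)
  ident n := (h.ident n).comp measurable_neg
  bpos := h.bpos
  bdd n ω := by simpa using h.bdd n ω
  mean := by rw [integral_neg, h.mean, neg_zero]
  sq := by simpa using h.sq

lemma pSum_neg (n : ℕ) (ω : Ω) : pSum (fun n ω => - Z n ω) n ω = - pSum Z n ω := by
  simp [pSum]

lemma StdSeq.measurable_pSum (h : StdSeq P Z B) (n : ℕ) : Measurable (pSum Z n) :=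
  Finset.measurable_fun_sum _ fun k _ => h.meas k

lemma StdSeq.integrable (h : StdSeq P Z B) (n : ℕ) : Integrable (Z n) P :=
  Integrable.of_bound (h.meas n).aestronglyMeasurable B
    (ae_of_all _ fun ω => by simpa using h.bdd n ω)

lemma StdSeq.mean' (h : StdSeq P Z B) (n : ℕ) : ∫ ω, Z n ω ∂P = 0 := by
  rw [(h.ident n).integral_eq, h.mean]

lemma StdSeq.sq' (h : StdSeq P Z B) (n : ℕ) : ∫ ω, (Z n ω) ^ 2 ∂P = 1 := by
  rw [← h.sq]
  exact ((h.ident n).comp (u := fun x : ℝ => x ^ 2) (by fun_prop)).integral_eq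

lemma StdSeq.integrable_exp (h : StdSeq P Z B) (n : ℕ) (l : ℝ) (hl : 0 ≤ l) :
    Integrable (fun ω => exp (l * Z n ω)) P := by
  refine Integrable.of_bound (C := exp (l * B)) ?_ (ae_of_all _ fun ω => ?_)
  · have := h.meas n
    fun_prop
  · rw [norm_of_nonneg (exp_pos _).le]
    gcongr
    exact (le_abs_self _).trans (h.bdd n ω)

lemma exp_le_quad (x : ℝ) (hx : |x| ≤ 1) : exp x ≤ 1 + x + x ^ 2 / 2 + |x| * x ^ 2 := by
  have h := Real.exp_bound hx (n := 3) (by norm_num)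
  have h2 := (abs_le.1 h).2
  simp [Finset.sum_range_succ, Nat.factorial] at h2
  have h3 : |x| ^ 3 = |x| * x ^ 2 := by rw [← sq_abs]; ring
  have h4 : 0 ≤ |x| * x ^ 2 := by positivity
  rw [h3] at h2
  linarith

lemma StdSeq.mgf_le (h : StdSeq P Z B) (n : ℕ) (l : ℝ) (hl : 0 ≤ l) (hlB : l * B ≤ 1) :
    ∫ ω, exp (l * Z n ω) ∂P ≤ exp (l ^ 2 / 2 * (1 + 2 * l * B)) := by
  have hb : ∀ ω, exp (l * Z n ω) ≤ 1 + l * Z n ω + (l ^ 2 / 2 * (1 + 2 * l * B)) * (Z n ω) ^ 2 := by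
    intro ω
    have hx : |l * Z n ω| ≤ l * B := by
      rw [abs_mul, abs_of_nonneg hl]
      exact mul_le_mul_of_nonneg_left (h.bdd n ω) hl
    have := exp_le_quad (l * Z n ω) (hx.trans hlB)
    have h2 : |l * Z n ω| * (l * Z n ω) ^ 2 ≤ l * B * (l * Z n ω) ^ 2 := by gcongr
    nlinarith
  have hi2 : Integrable (fun ω => (Z n ω) ^ 2) P := by
    refine Integrable.of_bound (C := B ^ 2) ?_ (ae_of_all _ fun ω => ?_)
    · have := h.meas n
      fun_prop
    · rw [norm_pow]
      gcongr
      exact h.bdd n ω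
  have hi1 := h.integrable n
  calc ∫ ω, exp (l * Z n ω) ∂P
      ≤ ∫ ω, (1 + l * Z n ω + (l ^ 2 / 2 * (1 + 2 * l * B)) * (Z n ω) ^ 2) ∂P := by
        refine integral_mono (h.integrable_exp n l hl) ?_ hb
        exact ((integrable_const _).add (hi1.const_mul _)).add (hi2.const_mul _)
    _ = 1 + l ^ 2 / 2 * (1 + 2 * l * B) := by
        have i1 : Integrable (fun ω => 1 + l * Z n ω) P :=
          (integrable_const _).add (hi1.const_mul _)
        rw [integral_add i1 (hi2.const_mul _),
          integral_add (integrable_const _) (hi1.const_mul _), integral_const_mul,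
          integral_const_mul, h.mean', h.sq']
        simp
    _ ≤ _ := by
        rw [add_comm]; exact add_one_le_exp _

lemma StdSeq.one_le_mgf (h : StdSeq P Z B) (n : ℕ) (l : ℝ) (hl : 0 ≤ l) :
    1 ≤ ∫ ω, exp (l * Z n ω) ∂P := by
  calc (1 : ℝ) = ∫ ω, (l * Z n ω + 1) ∂P := by
        rw [integral_add ((h.integrable n).const_mul _) (integrable_const _), integral_const_mul,
          h.mean']
        simp
    _ ≤ _ := by
        refine integral_mono (((h.integrable n).const_mul _).add (integrable_const _))
          (h.integrable_exp n l hl) fun ω => add_one_le_exp _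

lemma StdSeq.abs_pSum_le (h : StdSeq P Z B) (n : ℕ) (ω : Ω) : |pSum Z n ω| ≤ n * B := by
  calc |pSum Z n ω| ≤ ∑ k ∈ Finset.range n, |Z k ω| := Finset.abs_sum_le_sum_abs _ _
    _ ≤ ∑ k ∈ Finset.range n, B := Finset.sum_le_sum fun k _ => h.bdd k ω
    _ = n * B := by simp

lemma StdSeq.integrable_exp_pSum (h : StdSeq P Z B) (n : ℕ) (l : ℝ) (hl : 0 ≤ l) :
    Integrable (fun ω => exp (l * pSum Z n ω)) P := by
  refine Integrable.of_bound (C := exp (l * (n * B))) ?_ (ae_of_all _ fun ω => ?_)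
  · have := h.measurable_pSum n
    fun_prop
  · rw [norm_of_nonneg (exp_pos _).le]
    gcongr
    exact (le_abs_self _).trans (h.abs_pSum_le n ω)

lemma StdSeq.mgf_pSum_le (h : StdSeq P Z B) (n : ℕ) (l : ℝ) (hl : 0 ≤ l) (hlB : l * B ≤ 1) :
    ∫ ω, exp (l * pSum Z n ω) ∂P ≤ exp (n * (l ^ 2 / 2 * (1 + 2 * l * B))) := by
  have h1 : mgf (∑ k ∈ Finset.range n, Z k) P l = ∏ k ∈ Finset.range n, mgf (Z k) P l :=
    h.indep.mgf_sum h.meas _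
  have h2 : ∫ ω, exp (l * pSum Z n ω) ∂P = mgf (∑ k ∈ Finset.range n, Z k) P l := by
    simp [mgf, pSum, Finset.sum_apply]
  rw [h2, h1, exp_nat_mul]
  calc _ ≤ ∏ k ∈ Finset.range n, exp (l ^ 2 / 2 * (1 + 2 * l * B)) :=
        Finset.prod_le_prod (fun _ _ => mgf_nonneg) fun k _ => h.mgf_le k l hl hlB
    _ = _ := by simp

lemma StdSeq.submart (h : StdSeq P Z B) (l : ℝ) (hl : 0 ≤ l) :
    Submartingale (fun n ω => exp (l * pSum Z (n + 1) ω))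
      (Filtration.natural Z (fun n => (h.meas n).stronglyMeasurable)) P := by
  set F := Filtration.natural Z (fun n => (h.meas n).stronglyMeasurable) with hF
  have hZF : ∀ k n, k ≤ n → Measurable[F n] (Z k) := by
    intro k n hkn
    have := (Filtration.stronglyAdapted_natural (fun n => (h.meas n).stronglyMeasurable) k).measurable
    exact this.mono (F.mono hkn) le_rfl
  have hSF : ∀ n, Measurable[F n] (fun ω => exp (l * pSum Z (n + 1) ω)) := by
    intro n
    have : Measurable[F n] (pSum Z (n + 1)) :=
      Finset.measurable_fun_sum _ fun k hk => hZF k n (by simp at hk; omega)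
    exact measurable_exp.comp (this.const_mul l)
  refine submartingale_nat (fun n => (hSF n).stronglyMeasurable)
    (fun n => h.integrable_exp_pSum (n + 1) l hl) fun n => ?_
  have e : (fun ω => exp (l * pSum Z (n + 1 + 1) ω))
      = (fun ω => exp (l * pSum Z (n + 1) ω)) * (fun ω => exp (l * Z (n + 1) ω)) := by
    ext ω
    simp only [Pi.mul_apply, ← exp_add]
    rw [pSum, Finset.sum_range_succ, ← pSum]
    ring_nf
  have c1 : P[(fun ω => exp (l * pSum Z (n + 1 + 1) ω)) | F n] =ᵐ[P]
      (fun ω => exp (l * pSum Z (n + 1) ω)) * P[(fun ω => exp (l * Z (n + 1) ω)) | F n] := by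
    rw [e]
    refine condExp_mul_of_stronglyMeasurable_left (hSF n).stronglyMeasurable ?_ ?_
    · rw [← e]; exact h.integrable_exp_pSum _ l hl
    · exact h.integrable_exp _ l hl
  have c2 : P[(fun ω => exp (l * Z (n + 1) ω)) | F n] =ᵐ[P]
      fun _ => ∫ ω, exp (l * Z (n + 1) ω) ∂P := by
    have hi := h.indep.indep_comap_natural_of_lt (fun n => (h.meas n).stronglyMeasurable)
      (Nat.lt_succ_self n)
    refine condExp_indep_eq (m₁ := MeasurableSpace.comap (Z (n + 1)) inferInstance)
      (h.meas (n + 1)).comap_le (F.le n) ?_ hi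
    have : Measurable[MeasurableSpace.comap (Z (n + 1)) inferInstance] (Z (n + 1)) :=
      comap_measurable _
    exact (measurable_exp.comp (this.const_mul l)).stronglyMeasurable
  filter_upwards [c1, c2] with ω h1 h2
  rw [h1, Pi.mul_apply, h2]
  exact le_mul_of_one_le_right (exp_pos _).le (h.one_le_mgf _ l hl)

lemma StdSeq.max_ineq (h : StdSeq P Z B) (N : ℕ) (l a : ℝ) (hl : 0 < l) (hlB : l * B ≤ 1)
    (ha : 0 < a) :
    P {ω | ∃ n ≤ N, a ≤ pSum Z n ω} ≤
      ENNReal.ofReal (exp (- (l * a) + N * (l ^ 2 / 2 * (1 + 2 * l * B)))) := by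
  rcases Nat.eq_zero_or_pos N with rfl | hN
  · have : {ω | ∃ n ≤ 0, a ≤ pSum Z n ω} = ∅ := by
      ext ω; simp [pSum, ha]
    rw [this]; simp
  obtain ⟨M, rfl⟩ : ∃ M, N = M + 1 := ⟨N - 1, by omega⟩
  have hd := maximal_ineq (h.submart l hl.le) (fun n ω => (exp_pos _).le)
    (ε := (exp (l * a)).toNNReal) M
  set E := {ω | ((exp (l * a)).toNNReal : ℝ) ≤
    (Finset.range (M + 1)).sup' Finset.nonempty_range_add_one
      fun k => exp (l * pSum Z (k + 1) ω)} with hE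
  have hsub : {ω | ∃ n ≤ M + 1, a ≤ pSum Z n ω} ⊆ E := by
    rintro ω ⟨n, hn, han⟩
    have hn0 : n ≠ 0 := by
      rintro rfl
      simp [pSum] at han
      linarith
    obtain ⟨k, rfl⟩ := Nat.exists_eq_succ_of_ne_zero hn0
    simp only [hE, Set.mem_ofPred_eq, Real.coe_toNNReal _ (exp_pos _).le, Finset.le_sup'_iff]
    refine ⟨k, by simp; omega, ?_⟩
    gcongr
  have h2 : ∫ ω in E, exp (l * pSum Z (M + 1) ω) ∂P ≤
      exp ((M + 1 : ℕ) * (l ^ 2 / 2 * (1 + 2 * l * B))) :=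
    (setIntegral_le_integral (h.integrable_exp_pSum _ l hl.le)
      (ae_of_all _ fun ω => (exp_pos _).le)).trans (h.mgf_pSum_le (M + 1) l hl.le hlB)
  refine (measure_mono hsub).trans ?_
  have hc : ((exp (l * a)).toNNReal : ℝ≥0∞) = ENNReal.ofReal (exp (l * a)) := rfl
  have hd2 := hd.trans (ENNReal.ofReal_le_ofReal h2)
  rw [hc] at hd2
  rw [exp_add, ENNReal.ofReal_mul (exp_pos _).le, exp_neg, ENNReal.ofReal_inv_of_pos (exp_pos _)]
  rw [mul_comm, ← div_eq_mul_inv]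
  rw [ENNReal.le_div_iff_mul_le (Or.inl (by simp [exp_pos])) (Or.inl (by simp)), mul_comm]
  exact hd2

/-- The LIL normalization. -/
def lilNorm (n : ℕ) : ℝ := Real.sqrt (2 * n * Real.log (Real.log n))

lemma tendsto_log_div_pow (c : ℝ) (hc : 1 < c) :
    Tendsto (fun k : ℕ => Real.sqrt (2 * log k / c ^ k)) atTop (𝓝 0) := by
  have h1 := tendsto_pow_const_div_const_pow_of_one_lt 1 hc
  have h2 : Tendsto (fun k : ℕ => 2 * log k / c ^ k) atTop (𝓝 0) := by
    have h3 : Tendsto (fun k : ℕ => 2 * ((k : ℝ) ^ 1 / c ^ k)) atTop (𝓝 0) := by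
      simpa using h1.const_mul 2
    refine squeeze_zero' ?_ ?_ h3
    · filter_upwards [eventually_ge_atTop 1] with k hk
      have : 0 ≤ log (k : ℝ) := log_natCast_nonneg k
      have : 0 < c := by linarith
      positivity
    · filter_upwards [eventually_ge_atTop 1] with k hk
      have : 0 < c := by linarith
      have h4 : log (k : ℝ) ≤ k := by
        have := log_le_sub_one_of_pos (show (0 : ℝ) < k by exact_mod_cast hk)
        linarith
      rw [pow_one, mul_div_assoc]
      gcongr
  have := (Real.continuous_sqrt.tendsto 0).comp h2
  simpa [Function.comp_def] using this

lemma tendsto_log_nat : Tendsto (fun k : ℕ => log (k : ℝ)) atTop atTop :=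
  tendsto_log_atTop.comp tendsto_natCast_atTop_atTop

lemma StdSeq.upper (h : StdSeq P Z B) (a : ℝ) (ha : 1 < a) :
    ∀ᵐ ω ∂P, ∀ᶠ n : ℕ in atTop, pSum Z n ω ≤ a * lilNorm n := by
  obtain ⟨c, hc1, hca⟩ : ∃ c : ℝ, 1 < c ∧ c * c = a :=
    ⟨√a, by rw [Real.lt_sqrt (by norm_num)]; simpa using ha, Real.mul_self_sqrt (by linarith)⟩
  have hc0 : 0 < c := by linarith
  have hlc : 0 < log c := log_pos hc1
  have hBpos := h.bpos
  set b : ℕ → ℝ := fun k => c * √(2 * c ^ k * log k) with hb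
  set A : ℕ → Set Ω := fun k => {ω | ∃ n ≤ ⌊c ^ (k + 1)⌋₊, b k ≤ pSum Z n ω} with hA
  -- the three eventual conditions
  have hev : ∀ᶠ k : ℕ in atTop, 2 ≤ k ∧ log k ≤ c * (log k + log (log c)) ∧
      √(2 * log k / c ^ k) * B ≤ 1 ∧ c * (2 * (√(2 * log k / c ^ k) * B)) ≤ (c - 1) / 2 := by
    have t := (tendsto_log_div_pow c hc1).mul_const B
    rw [zero_mul] at t
    have t2 := (t.const_mul 2).const_mul c
    rw [mul_zero, mul_zero] at t2
    have t3 : Tendsto (fun k : ℕ => (c - 1) * log (k : ℝ)) atTop atTop :=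
      tendsto_log_nat.const_mul_atTop (by linarith)
    filter_upwards [eventually_ge_atTop 2, t.eventually_le_const (show (0 : ℝ) < 1 by norm_num),
      t2.eventually_le_const (show (0 : ℝ) < (c - 1) / 2 by linarith),
      t3.eventually_ge_atTop (- (c * log (log c)))] with k h1 h2 h3 h4
    exact ⟨h1, by linarith, h2, h3⟩
  obtain ⟨K, hK⟩ := eventually_atTop.1 hev
  set β : ℝ := (c + 1) / 2 with hβ
  have hbound : ∀ k ≥ K, P (A k) ≤ ENNReal.ofReal ((k : ℝ) ^ (-β)) := by
    intro k hk
    obtain ⟨k2, _, k3, k4⟩ := hK k hk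
    have hkr : (2 : ℝ) ≤ k := by exact_mod_cast k2
    have hlk : 0 < log (k : ℝ) := log_pos (by linarith)
    have hck : 0 < c ^ k := by positivity
    set l := √(2 * log k / c ^ k) with hl
    have hlsq : l ^ 2 = 2 * log k / c ^ k := Real.sq_sqrt (by positivity)
    have hlpos : 0 < l := Real.sqrt_pos.2 (by positivity)
    have hlb : l * b k = 2 * c * log k := by
      have : √(2 * log k / c ^ k) * √(2 * c ^ k * log k) = 2 * log k := by
        rw [← Real.sqrt_mul (by positivity),
          show 2 * log k / c ^ k * (2 * c ^ k * log k) = (2 * log (k : ℝ)) ^ 2 by field_simp]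
        exact Real.sqrt_sq (by positivity)
      simp only [hb, hl]
      linear_combination c * this
    have hbk : 0 < b k := by simp only [hb]; positivity
    refine (h.max_ineq ⌊c ^ (k + 1)⌋₊ l (b k) hlpos k3 hbk).trans ?_
    apply ENNReal.ofReal_le_ofReal
    rw [rpow_def_of_pos (by linarith)]
    gcongr
    have hfl : (⌊c ^ (k + 1)⌋₊ : ℝ) ≤ c ^ (k + 1) := Nat.floor_le (by positivity)
    have h5 : (⌊c ^ (k + 1)⌋₊ : ℝ) * (l ^ 2 / 2 * (1 + 2 * l * B)) ≤
        c ^ (k + 1) * (l ^ 2 / 2 * (1 + 2 * l * B)) := by gcongr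
    have h6 : c ^ (k + 1) * (l ^ 2 / 2 * (1 + 2 * l * B)) = log k * (c + c * (2 * (l * B))) := by
      rw [hlsq, pow_succ]; field_simp
    have h7 : log k * (c * (2 * (l * B))) ≤ log k * ((c - 1) / 2) := by gcongr
    rw [hlb]
    nlinarith
  have hsum : ∑' k, P (if K ≤ k then A k else ∅) ≠ ∞ := by
    have hs : Summable (fun k : ℕ => (k : ℝ) ^ (-β)) :=
      Real.summable_nat_rpow.2 (by linarith)
    refine ne_top_of_le_ne_top hs.tsum_ofReal_ne_top (ENNReal.tsum_le_tsum fun k => ?_)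
    split_ifs with hk
    · exact hbound k hk
    · simp
  filter_upwards [ae_eventually_notMem hsum] with ω hω
  obtain ⟨K', hK'⟩ := eventually_atTop.1 hω
  set M := max K K' with hM
  have hlarge : ∀ᶠ n : ℕ in atTop, c ^ (M + 1) ≤ (n : ℝ) :=
    tendsto_natCast_atTop_atTop.eventually_ge_atTop _
  filter_upwards [hlarge] with n hn
  have hn1 : (1 : ℝ) ≤ n := le_trans (one_le_pow₀ hc1.le) hn
  obtain ⟨k, hk1, hk2⟩ := exists_nat_pow_near hn1 hc1
  have hMk : M ≤ k := by
    have : c ^ (M + 1) < c ^ (k + 1) := lt_of_le_of_lt hn hk2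
    have := (pow_lt_pow_iff_right₀ hc1).1 this
    omega
  have hKk : K ≤ k := le_trans (le_max_left _ _) hMk
  have hnot := hK' k (le_trans (le_max_right _ _) hMk)
  rw [if_pos hKk] at hnot
  obtain ⟨k2, k3, _, _⟩ := hK k hKk
  have hkr : (2 : ℝ) ≤ k := by exact_mod_cast k2
  have hlt : pSum Z n ω < b k := by
    by_contra hcon
    exact hnot ⟨n, Nat.le_floor hk2.le, not_lt.1 hcon⟩
  refine hlt.le.trans ?_
  have hll : log k + log (log c) ≤ log (log n) := by
    rw [← log_mul (by linarith) hlc.ne', ← log_pow]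
    have : 0 < log (c ^ k) := by rw [log_pow]; positivity
    gcongr
  rw [← hca, mul_assoc]
  simp only [hb]
  gcongr
  have : lilNorm n * c = √(2 * n * log (log n) * (c * c)) := by
    rw [lilNorm, Real.sqrt_mul' (2 * n * log (log n)) (mul_self_nonneg c), Real.sqrt_mul_self hc0.le]
  rw [mul_comm c (lilNorm n), this]
  apply Real.sqrt_le_sqrt
  have hlk : 0 < log (k : ℝ) := log_pos (by linarith)
  have hll0 : 0 ≤ log (log (n : ℝ)) := by
    by_contra hcon
    have : c * (log k + log (log c)) ≤ c * log (log n) := by gcongr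
    nlinarith
  calc 2 * c ^ k * log k ≤ 2 * n * (c * (log k + log (log c))) := by gcongr
    _ ≤ 2 * n * (c * log (log n)) := by gcongr
    _ ≤ 2 * n * (c * log (log n)) * c := le_mul_of_one_le_right (by positivity) hc1.le
    _ = _ := by ring

/-- Sum of a block of `b` terms starting at `s`. -/
def bSum {Ω : Type*} (Z : ℕ → Ω → ℝ) (s b : ℕ) (ω : Ω) : ℝ := ∑ i ∈ Finset.range b, Z (s + i) ω

lemma pSum_add (s b : ℕ) (ω : Ω) : pSum Z (s + b) ω = pSum Z s ω + bSum Z s b ω := by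
  simp [pSum, bSum, Finset.sum_range_add]

lemma StdSeq.bSum_law (h : StdSeq P Z B) (s b : ℕ) (a : ℝ) :
    P {ω | a ≤ bSum Z s b ω} = P {ω | a ≤ pSum Z b ω} := by
  have h1 : IdentDistrib (fun ω i => Z (s + i) ω) (fun ω i => Z i ω) P P := by
    refine IdentDistrib.pi (X := fun i => Z (s + i)) (Y := Z) (fun i => ?_)
      (h.indep.precomp (g := fun i => s + i) (add_right_injective s)) h.indep
    exact (h.ident (s + i)).trans (h.ident i).symm
  have h2 := h1.comp (u := fun x : ℕ → ℝ => ∑ i ∈ Finset.range b, x i) (by fun_prop)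
  exact h2.measure_mem_eq (s := Set.Ici a) measurableSet_Ici

/-- σ-algebra generated by the variables with index in `S`. -/
@[reducible] def gen {Ω : Type*} (Z : ℕ → Ω → ℝ) (S : Set ℕ) : MeasurableSpace Ω :=
  ⨆ i ∈ S, MeasurableSpace.comap (Z i) inferInstance

lemma measurable_gen (S : Set ℕ) (i : ℕ) (hi : i ∈ S) : Measurable[gen Z S] (Z i) := by
  have h1 : MeasurableSpace.comap (Z i) inferInstance ≤ gen Z S :=
    le_iSup₂ (f := fun i (_ : i ∈ S) => MeasurableSpace.comap (Z i) inferInstance) i hi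
  exact (comap_measurable (Z i)).mono h1 le_rfl

lemma StdSeq.indep_gen (h : StdSeq P Z B) (S T : Set ℕ) (hST : Disjoint S T) :
    Indep (gen Z S) (gen Z T) P :=
  indep_iSup_of_disjoint (fun k => (h.meas k).comap_le) h.indep hST

lemma measurable_gen_bSum (S : Set ℕ) (s b : ℕ) (hS : ∀ i, s ≤ i → i < s + b → i ∈ S) :
    Measurable[gen Z S] (bSum Z s b) :=
  Finset.measurable_fun_sum _ fun i hi => measurable_gen S (s + i)
    (hS _ (by omega) (by simp at hi; omega))

lemma measurable_gen_pSum (S : Set ℕ) (b : ℕ) (hS : ∀ i, i < b → i ∈ S) :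
    Measurable[gen Z S] (pSum Z b) :=
  Finset.measurable_fun_sum _ fun i hi => measurable_gen S i (hS _ (by simpa using hi))

lemma StdSeq.blocks (h : StdSeq P Z B) (a : ℝ) (b m : ℕ) :
    P {ω | a ≤ pSum Z b ω} ^ m ≤ P {ω | m * a ≤ pSum Z (m * b) ω} := by
  induction m with
  | zero => simp [pSum]
  | succ m ih =>
    have hi := h.indep_gen {i | i < m * b} {i | m * b ≤ i} (by
      rw [Set.disjoint_left]; intro i hi; simpa using hi)
    rw [Indep_iff] at hi
    have h1 : MeasurableSet[gen Z {i | i < m * b}] {ω | m * a ≤ pSum Z (m * b) ω} :=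
      measurable_gen_pSum _ _ (fun i hi => hi) measurableSet_Ici
    have h2 : MeasurableSet[gen Z {i | m * b ≤ i}] {ω | a ≤ bSum Z (m * b) b ω} :=
      measurable_gen_bSum _ _ _ (fun i hi _ => hi) measurableSet_Ici
    have h3 := hi _ _ h1 h2
    rw [h.bSum_law] at h3
    calc P {ω | a ≤ pSum Z b ω} ^ (m + 1) ≤ P {ω | m * a ≤ pSum Z (m * b) ω}
          * P {ω | a ≤ pSum Z b ω} := by rw [pow_succ]; gcongr
      _ = _ := h3.symm
      _ ≤ _ := by
        apply measure_mono
        rintro ω ⟨h4, h5⟩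
        simp only [Set.mem_ofPred_eq] at h4 h5 ⊢
        rw [add_mul, one_mul, pSum_add]
        push_cast
        linarith

lemma gauss_tail (t : ℝ) (ht : 0 ≤ t) :
    ENNReal.ofReal (exp (-((t + 1) ^ 2 / 2 + 1))) < gaussianReal 0 1 (Set.Ioi t) := by
  have h1 : ENNReal.ofReal ((√(2 * π))⁻¹ * exp (-((t + 1) ^ 2 / 2))) ≤
      gaussianReal 0 1 (Set.Ioi t) := by
    rw [gaussianReal_apply _ (by simp)]
    calc ENNReal.ofReal ((√(2 * π))⁻¹ * exp (-((t + 1) ^ 2 / 2)))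
        = ∫⁻ x in Set.Ioo t (t + 1), ENNReal.ofReal ((√(2 * π))⁻¹ * exp (-((t + 1) ^ 2 / 2))) := by
          simp
      _ ≤ ∫⁻ x in Set.Ioo t (t + 1), gaussianPDF 0 1 x := by
          refine setLIntegral_mono' measurableSet_Ioo fun x hx => ?_
          rw [gaussianPDF, gaussianPDFReal]
          apply ENNReal.ofReal_le_ofReal
          simp only [NNReal.coe_one, mul_one, sub_zero, neg_div]
          have : x ^ 2 ≤ (t + 1) ^ 2 := by
            have := hx.1
            have := hx.2
            gcongr
            linarith
          gcongr
      _ ≤ _ := lintegral_mono_set Set.Ioo_subset_Ioi_self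
  refine lt_of_lt_of_le ?_ h1
  rw [ENNReal.ofReal_lt_ofReal_iff (by positivity), neg_add, exp_add, mul_comm]
  gcongr
  rw [exp_neg]
  gcongr
  rw [Real.sqrt_lt' (by positivity)]
  have := Real.exp_one_gt_d9
  have := Real.pi_lt_d2
  nlinarith

lemma StdSeq.clt (h : StdSeq P Z B) :
    TendstoInDistribution (fun (n : ℕ) ω ↦ (√n)⁻¹ * pSum Z n ω) atTop (id : ℝ → ℝ)
      (fun _ ↦ P) (gaussianReal 0 1) :=
  tendstoInDistribution_inv_sqrt_mul_sum (X := Z) HasLaw.id h.mean h.sq h.indep h.ident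

lemma StdSeq.clt_tail (h : StdSeq P Z B) (t : ℝ) (ht : 0 ≤ t) :
    ∀ᶠ b : ℕ in atTop, ENNReal.ofReal (exp (-((t + 1) ^ 2 / 2 + 1))) ≤
      P {ω | t * √b ≤ pSum Z b ω} := by
  have h1 := ProbabilityMeasure.le_liminf_measure_open_of_tendsto h.clt.tendsto
    (isOpen_Ioi (a := t))
  have h2 := gauss_tail t ht
  simp only [ProbabilityMeasure.coe_mk, Measure.map_id] at h1
  have h3 := eventually_lt_of_lt_liminf (lt_of_lt_of_le h2 h1)
  filter_upwards [h3, eventually_gt_atTop 0] with b hb hb0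
  refine hb.le.trans ?_
  rw [Measure.map_apply (by have := h.measurable_pSum b; fun_prop) measurableSet_Ioi]
  apply measure_mono
  intro ω hω
  have hs : 0 < √(b : ℝ) := Real.sqrt_pos.2 (by exact_mod_cast hb0)
  simp only [Set.mem_preimage, Set.mem_Ioi] at hω
  simp only [Set.mem_ofPred_eq]
  rw [← div_eq_inv_mul, lt_div_iff₀ hs] at hω
  exact hω.le

lemma my_sqrt_add (x y : ℝ) (hx : 0 ≤ x) (hy : 0 ≤ y) : √(x + y) ≤ √x + √y := by
  rw [Real.sqrt_le_left (by positivity)]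
  nlinarith [Real.sq_sqrt hx, Real.sq_sqrt hy, mul_nonneg (Real.sqrt_nonneg x) (Real.sqrt_nonneg y)]

lemma StdSeq.tail_lower (h : StdSeq P Z B) (a : ℝ) (ha0 : 0 < a) (ha1 : a < 1) (c : ℕ)
    (hc : 2 ≤ c) : ∃ θ < (1 : ℝ), ∃ C > (0 : ℝ), ∀ᶠ k : ℕ in atTop,
      ENNReal.ofReal (C * (k : ℝ) ^ (-θ)) ≤
        P {ω | a * √(2 * log k * (c ^ k * (c - 1) : ℕ)) ≤ pSum Z (c ^ k * (c - 1)) ω} := by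
  obtain ⟨a', haa', ha'1⟩ := exists_between ha1
  have ha'0 : 0 < a' := ha0.trans haa'
  have hBpos := h.bpos
  have hd : 0 < 1 - a' ^ 2 := by nlinarith
  set t : ℝ := 1 + 5 * a' ^ 2 / (1 - a' ^ 2) with ht
  have ht1 : 1 ≤ t := by
    have : 0 ≤ 5 * a' ^ 2 / (1 - a' ^ 2) := by positivity
    linarith
  have ht0 : 0 < t := by linarith
  set G : ℝ := (t + 1) ^ 2 / 2 + 1 with hG
  have hG0 : 0 < G := by positivity
  have hθ : G * (2 * a' ^ 2 / t ^ 2) < 1 := by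
    have h1 : 5 * a' ^ 2 < (1 - a' ^ 2) * t := by
      have : 5 * a' ^ 2 / (1 - a' ^ 2) < t := by linarith
      rw [div_lt_iff₀ hd] at this
      linarith
    have h2 : G * (2 * a' ^ 2 / t ^ 2) = (a' ^ 2 * ((t + 1) ^ 2 + 2)) / t ^ 2 := by
      rw [hG]; field_simp
    rw [h2, div_lt_one (by positivity)]
    have h3 : 5 * a' ^ 2 * t < (1 - a' ^ 2) * t * t := by gcongr
    nlinarith [sq_nonneg a']
  obtain ⟨b0, hb0⟩ := eventually_atTop.1 (h.clt_tail t ht0.le)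
  refine ⟨G * (2 * a' ^ 2 / t ^ 2), hθ, exp (-G), exp_pos _, ?_⟩
  have E1 : ∀ᶠ k : ℕ in atTop, 1 ≤ log (k : ℝ) := tendsto_log_nat.eventually_ge_atTop 1
  have E2 : ∀ᶠ k : ℕ in atTop, 2 * log (k : ℝ) + 1 ≤ k := by
    have := (Real.isLittleO_log_id_atTop.comp_tendsto tendsto_natCast_atTop_atTop).bound
      (show (0 : ℝ) < 1 / 4 by norm_num)
    filter_upwards [this, eventually_ge_atTop 2] with k hk hk2
    have hk2' : (2 : ℝ) ≤ k := by exact_mod_cast hk2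
    simp at hk
    have := le_abs_self (log (k : ℝ))
    linarith
  have E3 : ∀ᶠ k : ℕ in atTop, (k : ℝ) * (1 + B) ≤ (a' - a) * √2 ^ k := by
    have := (tendsto_pow_const_div_const_pow_of_one_lt 1
      (show (1 : ℝ) < √2 by rw [Real.lt_sqrt] <;> norm_num))
    have h2 := this.eventually_le_const (show (0 : ℝ) < (a' - a) / (1 + B) by
      have : 0 < a' - a := by linarith
      positivity)
    filter_upwards [h2] with k hk
    rw [pow_one, div_le_div_iff₀ (by positivity) (by positivity)] at hk
    exact hk
  have E4 : ∀ᶠ k : ℕ in atTop, (k : ℝ) * b0 ≤ 2 ^ k := by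
    have := (tendsto_pow_const_div_const_pow_of_one_lt 1 (show (1 : ℝ) < 2 by norm_num))
    have h2 := this.eventually_le_const (show (0 : ℝ) < 1 / (b0 + 1) by positivity)
    filter_upwards [h2] with k hk
    rw [pow_one, div_le_div_iff₀ (by positivity) (by positivity)] at hk
    have : (0 : ℝ) ≤ k := by positivity
    linarith
  filter_upwards [E1, E2, E3, E4, eventually_ge_atTop 1] with k e1 e2 e3 e4 hk1
  set L : ℕ := c ^ k * (c - 1) with hL
  have hL2 : 2 ^ k ≤ L := by
    calc 2 ^ k ≤ c ^ k := Nat.pow_le_pow_left hc k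
      _ ≤ L := Nat.le_mul_of_pos_right _ (by omega)
  have hL2r : (2 : ℝ) ^ k ≤ L := by exact_mod_cast hL2
  set y : ℝ := 2 * a' ^ 2 / t ^ 2 * log k with hy
  have hy0 : 0 < y := by positivity
  set m : ℕ := ⌈y⌉₊ with hm
  have hm0 : 0 < m := Nat.ceil_pos.2 hy0
  have hmy : y ≤ m := Nat.le_ceil y
  have hmy' : (m : ℝ) ≤ y + 1 := (Nat.ceil_lt_add_one hy0.le).le
  have hmk : (m : ℝ) ≤ k := by
    have h1 : 2 * a' ^ 2 / t ^ 2 ≤ 2 := by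
      rw [div_le_iff₀ (by positivity)]
      nlinarith
    have : y ≤ 2 * log k := by
      rw [hy]; gcongr
    linarith
  have hmk' : m ≤ k := by exact_mod_cast hmk
  set b : ℕ := L / m with hb
  have hbb0 : b0 ≤ b := by
    rw [hb, Nat.le_div_iff_mul_le hm0]
    have h1 : k * b0 ≤ 2 ^ k := by exact_mod_cast e4
    calc b0 * m = m * b0 := mul_comm _ _
      _ ≤ k * b0 := Nat.mul_le_mul_right _ hmk'
      _ ≤ L := h1.trans hL2
  have hmb : m * b + L % m = L := Nat.div_add_mod L m
  have hmod : L % m < m := Nat.mod_lt _ hm0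
  have hm1r : (1 : ℝ) ≤ m := by exact_mod_cast hm0
  have hlow := h.blocks (t * √b) b m
  have hcl := hb0 b hbb0
  calc ENNReal.ofReal (exp (-G) * (k : ℝ) ^ (-(G * (2 * a' ^ 2 / t ^ 2))))
      ≤ ENNReal.ofReal (exp (-G) ^ m) := by
        apply ENNReal.ofReal_le_ofReal
        rw [rpow_def_of_pos (by positivity), ← exp_add, ← exp_nat_mul]
        gcongr
        have : G * m ≤ G * (y + 1) := by gcongr
        rw [hy] at this
        linarith
    _ = ENNReal.ofReal (exp (-G)) ^ m := ENNReal.ofReal_pow (exp_pos _).le m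
    _ ≤ P {ω | t * √b ≤ pSum Z b ω} ^ m := by gcongr
    _ ≤ _ := hlow
    _ ≤ _ := by
      apply measure_mono
      intro ω hω
      simp only [Set.mem_ofPred_eq] at hω ⊢
      have hrem : |bSum Z (m * b) (L % m) ω| ≤ m * B := by
        calc |bSum Z (m * b) (L % m) ω| ≤ ∑ i ∈ Finset.range (L % m), |Z (m * b + i) ω| :=
              Finset.abs_sum_le_sum_abs _ _
          _ ≤ ∑ i ∈ Finset.range (L % m), B := Finset.sum_le_sum fun i _ => h.bdd _ ω
          _ = (L % m : ℕ) * B := by simp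
          _ ≤ m * B := by gcongr
      have hS : pSum Z L ω = pSum Z (m * b) ω + bSum Z (m * b) (L % m) ω := by
        rw [← pSum_add, hmb]
      have hrem' := (abs_le.1 hrem).1
      rw [hS]
      -- the deterministic inequality
      set x : ℝ := √(2 * log k) with hx
      have hx1 : 1 ≤ x := by rw [hx, Real.one_le_sqrt]; linarith
      have g1 : a' * x ≤ t * √m := by
        have : a' * x = √(a' ^ 2 * (2 * log k)) := by
          rw [Real.sqrt_mul (by positivity), Real.sqrt_sq ha'0.le]
        have h2 : t * √m = √(t ^ 2 * m) := by
          rw [Real.sqrt_mul (by positivity), Real.sqrt_sq ht0.le]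
        rw [this, h2]
        apply Real.sqrt_le_sqrt
        have h3 : t ^ 2 * y ≤ t ^ 2 * m := by gcongr
        have h4 : t ^ 2 * y = a' ^ 2 * (2 * log k) := by rw [hy]; field_simp
        linarith
      have g2 : √L - m ≤ √m * √b := by
        rw [← Real.sqrt_mul (by positivity)]
        have h1 : (L : ℝ) ≤ m * b + m := by
          have : L ≤ m * b + m := by omega
          exact_mod_cast this
        have h2 : √L ≤ √(m * b) + √m :=
          (Real.sqrt_le_sqrt h1).trans (my_sqrt_add _ _ (by positivity) (by positivity))
        have h3 : √(m : ℝ) ≤ m := Real.sqrt_le_iff.2 ⟨by linarith, by nlinarith⟩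
        linarith
      have g3 : √2 ^ k ≤ √L := by
        apply Real.le_sqrt_of_sq_le
        rw [← pow_mul, mul_comm, pow_mul, Real.sq_sqrt (by norm_num)]
        exact hL2r
      have g4 : (m : ℝ) * (1 + B) ≤ (a' - a) * √L := by
        calc (m : ℝ) * (1 + B) ≤ k * (1 + B) := by gcongr
          _ ≤ _ := e3
          _ ≤ _ := by
            have : 0 ≤ a' - a := by linarith
            gcongr
      have g5 : (m : ℝ) * (t * √b) = (t * √m) * (√m * √b) := by
        have := Real.mul_self_sqrt (show (0 : ℝ) ≤ m by positivity)
        linear_combination (- t * √b) * this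
      have g6 : (a' * x) * (√m * √b) ≤ (t * √m) * (√m * √b) := by gcongr
      have g7 : (a' * x) * (√L - m) ≤ (a' * x) * (√m * √b) := by gcongr
      have g8 : √(2 * log k * L) = x * √L := by
        rw [Real.sqrt_mul (by positivity)]
      rw [g8]
      have g9 : (m : ℝ) * (a' + B) ≤ (a' - a) * √L := by
        refine le_trans ?_ g4
        gcongr
      have g10 : x * (m * (a' + B)) ≤ x * ((a' - a) * √L) := by gcongr
      have g11 : (m : ℝ) * B ≤ x * (m * B) := le_mul_of_one_le_left (by positivity) hx1
      linarith

lemma StdSeq.iIndepSet_blocks (h : StdSeq P Z B) (n : ℕ → ℕ) (len : ℕ → ℕ)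
    (hn : ∀ j k, j < k → n j + len j ≤ n k) (x : ℕ → ℝ) :
    iIndepSet (fun k => {ω | x k ≤ bSum Z (n k) (len k) ω}) P := by
  have hmeas : ∀ k, MeasurableSet {ω | x k ≤ bSum Z (n k) (len k) ω} := by
    intro k
    have : Measurable (bSum Z (n k) (len k)) := Finset.measurable_fun_sum _ fun i _ => h.meas _
    exact this measurableSet_Ici
  rw [iIndepSet_iff_meas_biInter hmeas]
  intro S
  induction S using Finset.induction_on_max with
  | empty => simp
  | insert K S hS ih =>
    have hK : K ∉ S := fun hh => lt_irrefl _ (hS K hh)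
    rw [Finset.prod_insert hK, Finset.set_biInter_insert, ← ih]
    have hi := h.indep_gen {i | n K ≤ i} {i | i < n K} (by
      rw [Set.disjoint_left]; intro i hi; simpa using hi)
    rw [Indep_iff] at hi
    apply hi
    · exact measurable_gen_bSum _ _ _ (fun i hi _ => hi) measurableSet_Ici
    · refine Finset.measurableSet_biInter _ fun j hj => ?_
      have := hn j K (hS j hj)
      exact measurable_gen_bSum _ _ _ (fun i _ hi => lt_of_lt_of_le hi this) measurableSet_Ici

lemma StdSeq.lower (h : StdSeq P Z B) (a : ℝ) (ha0 : 0 < a) (ha1 : a < 1) :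
    ∀ᵐ ω ∂P, ∃ᶠ n : ℕ in atTop, a * lilNorm n ≤ pSum Z n ω := by
  obtain ⟨a1, haa1, ha11⟩ := exists_between ha1
  obtain ⟨a2, haa2, ha21⟩ := exists_between haa1
  set ρ : ℝ := a2 / a with hρ
  have hρ1 : 1 < ρ := by rw [hρ, one_lt_div ha0]; exact haa2
  have haρ : a * ρ = a2 := by rw [hρ]; field_simp
  obtain ⟨c, hc2, hcc⟩ : ∃ c : ℕ, 3 ≤ c ∧ 2 * ρ + a1 ≤ (a1 - a2) * √c := by
    have : Tendsto (fun c : ℕ => (a1 - a2) * √(c : ℝ)) atTop atTop :=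
      (Real.tendsto_sqrt_atTop.comp tendsto_natCast_atTop_atTop).const_mul_atTop (by linarith)
    obtain ⟨c, h1, h2⟩ := ((eventually_ge_atTop 3).and
      (this.eventually_ge_atTop (2 * ρ + a1))).exists
    exact ⟨c, h1, h2⟩
  obtain ⟨θ, hθ, C, hC, hev⟩ := h.tail_lower a1 (by linarith) ha11 c (by omega)
  set E : ℕ → Set Ω := fun k =>
    {ω | a1 * √(2 * log k * (c ^ k * (c - 1) : ℕ)) ≤ bSum Z (c ^ k) (c ^ k * (c - 1)) ω} with hE
  have hcpow : ∀ k, c ^ k + c ^ k * (c - 1) = c ^ (k + 1) := by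
    intro k
    obtain ⟨d, rfl⟩ : ∃ d, c = d + 1 := ⟨c - 1, by omega⟩
    rw [Nat.add_sub_cancel, pow_succ]; ring
  have hind : iIndepSet E P := by
    refine h.iIndepSet_blocks (fun k => c ^ k) (fun k => c ^ k * (c - 1)) ?_ _
    intro j k hjk
    rw [hcpow]
    exact Nat.pow_le_pow_right (by omega) hjk
  have hEm : ∀ k, MeasurableSet (E k) := by
    intro k
    have : Measurable (bSum Z (c ^ k) (c ^ k * (c - 1))) :=
      Finset.measurable_fun_sum _ fun i _ => h.meas _
    exact this measurableSet_Ici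
  have hdiv : ∑' k, P (E k) = ∞ := by
    by_contra hne
    have hs : Summable (fun k => (P (E k)).toReal) := ENNReal.summable_toReal hne
    have hs2 : Summable (fun k : ℕ => C * (k : ℝ) ^ (-θ)) := by
      refine Summable.of_norm_bounded_eventually_nat hs ?_
      filter_upwards [hev] with k hk
      have h0 : 0 ≤ C * (k : ℝ) ^ (-θ) := by positivity
      rw [Real.norm_of_nonneg h0]
      rw [← h.bSum_law (c ^ k)] at hk
      exact (ENNReal.ofReal_le_iff_le_toReal (measure_ne_top _ _)).1 hk
    have hs3 := (summable_mul_left_iff hC.ne').1 hs2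
    rw [Real.summable_nat_rpow] at hs3
    linarith
  have hbc := measure_limsup_eq_one hEm hind hdiv
  have hlm : ∀ᵐ ω ∂P, ω ∈ limsup E atTop := by
    rw [← prob_compl_eq_zero_iff (MeasurableSet.measurableSet_limsup hEm)] at hbc
    exact hbc
  filter_upwards [hlm, h.neg.upper 2 (by norm_num)] with ω hω hup
  rw [mem_limsup_iff_frequently_mem] at hω
  have hpt : Tendsto (fun k : ℕ => c ^ k) atTop atTop :=
    tendsto_pow_atTop_atTop_of_one_lt (by omega)
  have hup2 := hpt.eventually hup
  have hpt2 : Tendsto (fun k : ℕ => c ^ (k + 1)) atTop atTop :=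
    hpt.comp (tendsto_add_atTop_nat 1)
  refine hpt2.frequently ?_
  have hc1r : (3 : ℝ) ≤ c := by exact_mod_cast hc2
  have hlc : 0 < log (c : ℝ) := log_pos (by linarith)
  have hlog : ∀ᶠ k : ℕ in atTop, 1 + log (log c) ≤ (ρ ^ 2 - 1) * log (k : ℝ) :=
    (tendsto_log_nat.const_mul_atTop (by nlinarith)).eventually_ge_atTop _
  refine (hω.and_eventually ((hup2.and hlog).and (eventually_ge_atTop 2))).mono ?_
  rintro k ⟨hEk, ⟨hupk, hlk⟩, hk2⟩
  have hk2r : (2 : ℝ) ≤ k := by exact_mod_cast hk2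
  have hlogk : 0 < log (k : ℝ) := log_pos (by linarith)
  rw [pSum_neg] at hupk
  have hEk' : a1 * √(2 * log k * (c ^ k * (c - 1) : ℕ)) ≤ bSum Z (c ^ k) (c ^ k * (c - 1)) ω := hEk
  rw [← hcpow, pSum_add, hcpow]
  have f1 : log (k + 1 : ℝ) ≤ log k + 1 := by
    have : (k + 1 : ℝ) ≤ k * exp 1 := by
      have := Real.exp_one_gt_d9
      nlinarith
    calc log (k + 1 : ℝ) ≤ log (k * exp 1) := by gcongr
      _ = log k + 1 := by rw [log_mul (by linarith) (exp_pos _).ne', log_exp]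
  set u : ℝ := 2 * log k * c ^ k with hu
  have hu0 : 0 < u := by positivity
  have n1 : lilNorm (c ^ k) ≤ ρ * √u := by
    have : ρ * √u = √(ρ ^ 2 * u) := by
      rw [Real.sqrt_mul (show 0 ≤ ρ ^ 2 by positivity) u, Real.sqrt_sq (show 0 ≤ ρ by linarith)]
    rw [this, lilNorm]
    apply Real.sqrt_le_sqrt
    push_cast
    rw [log_pow, log_mul (by linarith) hlc.ne']
    have : log k + log (log c) ≤ ρ ^ 2 * log k := by linarith
    calc 2 * (c : ℝ) ^ k * (log k + log (log c)) ≤ 2 * (c : ℝ) ^ k * (ρ ^ 2 * log k) := by gcongr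
      _ = _ := by rw [hu]; ring
  have n2 : lilNorm (c ^ (k + 1)) ≤ ρ * √c * √u := by
    have : ρ * √c * √u = √(ρ ^ 2 * c * u) := by
      rw [Real.sqrt_mul (show (0 : ℝ) ≤ ρ ^ 2 * c by positivity) u,
        Real.sqrt_mul (show 0 ≤ ρ ^ 2 by positivity) (c : ℝ),
        Real.sqrt_sq (show 0 ≤ ρ by linarith)]
    rw [this, lilNorm]
    apply Real.sqrt_le_sqrt
    push_cast
    rw [log_pow, log_mul (by positivity) hlc.ne']
    push_cast
    have : log (k + 1 : ℝ) + log (log c) ≤ ρ ^ 2 * log k := by linarith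
    calc 2 * (c : ℝ) ^ (k + 1) * (log (k + 1 : ℝ) + log (log c))
        ≤ 2 * (c : ℝ) ^ (k + 1) * (ρ ^ 2 * log k) := by gcongr
      _ = _ := by rw [hu]; ring
  have n3 : (√c - 1) * √u ≤ √(2 * log k * (c ^ k * (c - 1) : ℕ)) := by
    have h1 : √c - 1 ≤ √((c : ℝ) - 1) := by
      have : √(((c : ℝ) - 1) + 1) ≤ √((c : ℝ) - 1) + √1 :=
        my_sqrt_add _ _ (by linarith) (by norm_num)
      rw [Real.sqrt_one] at this
      simp only [sub_add_cancel] at this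
      linarith
    have h2 : 2 * log k * ((c ^ k * (c - 1) : ℕ) : ℝ) = ((c : ℝ) - 1) * u := by
      rw [Nat.cast_mul, Nat.cast_sub (by omega)]
      push_cast
      rw [hu]; ring
    rw [h2, Real.sqrt_mul (show (0 : ℝ) ≤ (c : ℝ) - 1 by linarith) u]
    exact mul_le_mul_of_nonneg_right h1 (Real.sqrt_nonneg _)
  have hsu : 0 ≤ √u := Real.sqrt_nonneg _
  have q1 : a * lilNorm (c ^ (k + 1)) ≤ a * (ρ * √c * √u) := by gcongr
  have q2 : a * (ρ * √c * √u) = a2 * √c * √u := by rw [← haρ]; ring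
  have q3 : a1 * ((√c - 1) * √u) ≤ a1 * √(2 * log k * (c ^ k * (c - 1) : ℕ)) := by
    have : 0 < a1 := by linarith
    gcongr
  have q4 : (2 * ρ + a1) * √u ≤ (a1 - a2) * √c * √u := by gcongr
  linarith

lemma tendsto_lilNorm : Tendsto lilNorm atTop atTop := by
  unfold lilNorm
  apply Real.tendsto_sqrt_atTop.comp
  have h1 : Tendsto (fun n : ℕ => 2 * (n : ℝ)) atTop atTop :=
    tendsto_natCast_atTop_atTop.const_mul_atTop (by norm_num)
  exact h1.atTop_mul_atTop₀ (Real.tendsto_log_atTop.comp tendsto_log_nat)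

lemma limsup_eq_aux (u : ℕ → ℝ) (s : ℝ) (h1 : ∀ ε > 0, ∀ᶠ n in atTop, u n ≤ s + ε)
    (h2 : ∀ ε > 0, ∃ᶠ n in atTop, s - ε ≤ u n) : limsup u atTop = s := by
  have hb : IsBoundedUnder (· ≤ ·) atTop u := ⟨s + 1, h1 1 one_pos⟩
  have hc : IsCoboundedUnder (· ≤ ·) atTop u :=
    IsCobounded.of_frequently_ge (h2 1 one_pos)
  apply le_antisymm
  · exact le_of_forall_pos_le_add fun ε hε => limsup_le_of_le hc (h1 ε hε)
  · refine le_of_forall_pos_le_add fun ε hε => ?_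
    have := le_limsup_of_frequently_le (h2 ε hε) hb
    linarith

lemma liminf_eq_aux (u : ℕ → ℝ) (s : ℝ) (h1 : ∀ ε > 0, ∀ᶠ n in atTop, s - ε ≤ u n)
    (h2 : ∀ ε > 0, ∃ᶠ n in atTop, u n ≤ s + ε) : liminf u atTop = s := by
  have hb : IsBoundedUnder (· ≥ ·) atTop u := ⟨s - 1, h1 1 one_pos⟩
  have hc : IsCoboundedUnder (· ≥ ·) atTop u :=
    IsCobounded.of_frequently_le (h2 1 one_pos)
  apply le_antisymm
  · exact le_of_forall_pos_le_add fun ε hε => liminf_le_of_frequently_le (h2 ε hε) hb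
  · refine le_of_forall_pos_le_add fun ε hε => ?_
    have := le_liminf_of_le hc (h1 ε hε)
    linarith

lemma path_upper (S e : ℕ → ℝ) (σ : ℝ) (hσ : 0 < σ) (he : ∀ n, |e n| ≤ 2)
    (hS : ∀ a > 1, ∀ᶠ n in atTop, S n ≤ a * lilNorm n) :
    ∀ ε > 0, ∀ᶠ n in atTop, (σ * S n + e n) / lilNorm n ≤ σ + ε := by
  intro ε hε
  filter_upwards [hS (1 + ε / (2 * σ)) (by linarith [show 0 < ε / (2 * σ) by positivity]),
    tendsto_lilNorm.eventually_ge_atTop (4 / ε), tendsto_lilNorm.eventually_gt_atTop 0]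
    with n h1 h2 h3
  rw [div_le_iff₀ h3]
  rw [div_le_iff₀ hε] at h2
  have h4 := (abs_le.1 (he n)).2
  have h5 := mul_le_mul_of_nonneg_left h1 hσ.le
  have h6 : σ * ((1 + ε / (2 * σ)) * lilNorm n) = (σ + ε / 2) * lilNorm n := by
    field_simp
  linarith

lemma path_lower (S e : ℕ → ℝ) (σ : ℝ) (hσ : 0 < σ) (he : ∀ n, |e n| ≤ 2)
    (hS : ∀ a > 0, a < 1 → ∃ᶠ n in atTop, a * lilNorm n ≤ S n) :
    ∀ ε > 0, ∃ᶠ n in atTop, σ - ε ≤ (σ * S n + e n) / lilNorm n := by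
  intro ε hε
  have hp : 0 < ε / (2 * σ) := by positivity
  refine ((hS (max (1 / 2) (1 - ε / (2 * σ))) (lt_max_of_lt_left (by norm_num))
    (max_lt (by norm_num) (by linarith))).and_eventually
    ((tendsto_lilNorm.eventually_ge_atTop (4 / ε)).and
      (tendsto_lilNorm.eventually_gt_atTop 0))).mono ?_
  rintro n ⟨h1, h2, h3⟩
  rw [le_div_iff₀ h3]
  rw [div_le_iff₀ hε] at h2
  have h4 := (abs_le.1 (he n)).1
  have h5 := mul_le_mul_of_nonneg_left h1 hσ.le
  have h7 : (1 - ε / (2 * σ)) * lilNorm n ≤ (max (1 / 2) (1 - ε / (2 * σ))) * lilNorm n :=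
    mul_le_mul_of_nonneg_right (le_max_right _ _) h3.le
  have h8 := mul_le_mul_of_nonneg_left h7 hσ.le
  have h6 : σ * ((1 - ε / (2 * σ)) * lilNorm n) = (σ - ε / 2) * lilNorm n := by
    field_simp
  linarith

lemma StdSeq.upper_all (h : StdSeq P Z B) :
    ∀ᵐ ω ∂P, ∀ a > 1, ∀ᶠ n : ℕ in atTop, pSum Z n ω ≤ a * lilNorm n := by
  have : ∀ᵐ ω ∂P, ∀ j : ℕ, ∀ᶠ n : ℕ in atTop, pSum Z n ω ≤ (1 + 1 / ((j : ℝ) + 1)) * lilNorm n :=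
    ae_all_iff.2 fun j => h.upper _ (by linarith [show 0 < 1 / ((j : ℝ) + 1) by positivity])
  filter_upwards [this] with ω hω a ha
  obtain ⟨j, hj⟩ := exists_nat_one_div_lt (show 0 < a - 1 by linarith)
  filter_upwards [hω j] with n hn
  refine hn.trans ?_
  have : 0 ≤ lilNorm n := Real.sqrt_nonneg _
  gcongr
  linarith

lemma StdSeq.lower_all (h : StdSeq P Z B) :
    ∀ᵐ ω ∂P, ∀ a > 0, a < 1 → ∃ᶠ n : ℕ in atTop, a * lilNorm n ≤ pSum Z n ω := by
  have : ∀ᵐ ω ∂P, ∀ j : ℕ, ∃ᶠ n : ℕ in atTop,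
      (1 - 1 / ((j : ℝ) + 2)) * lilNorm n ≤ pSum Z n ω := by
    refine ae_all_iff.2 fun j => h.lower _ ?_ ?_
    · have : 1 / ((j : ℝ) + 2) < 1 := by
        rw [div_lt_one (by positivity)]
        linarith [show (0 : ℝ) ≤ j by positivity]
      linarith
    · linarith [show 0 < 1 / ((j : ℝ) + 2) by positivity]
  filter_upwards [this] with ω hω a _ ha
  obtain ⟨j, hj⟩ := exists_nat_one_div_lt (show 0 < 1 - a by linarith)
  refine (hω j).mono fun n hn => ?_
  refine le_trans ?_ hn
  have : 0 ≤ lilNorm n := Real.sqrt_nonneg _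
  gcongr
  have : 1 / ((j : ℝ) + 2) ≤ 1 / ((j : ℝ) + 1) := by gcongr; norm_num
  linarith

lemma StdSeq.lil (h : StdSeq P Z B) (σ : ℝ) (hσ : 0 < σ) (e : ℕ → Ω → ℝ)
    (he : ∀ n ω, |e n ω| ≤ 2) :
    ∀ᵐ ω ∂P, limsup (fun n => (σ * pSum Z n ω + e n ω) / lilNorm n) atTop = σ ∧
      liminf (fun n => (σ * pSum Z n ω + e n ω) / lilNorm n) atTop = -σ := by
  filter_upwards [h.upper_all, h.lower_all, h.neg.upper_all, h.neg.lower_all]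
    with ω h1 h2 h3 h4
  simp only [pSum_neg] at h3 h4
  have he' : ∀ n, |-e n ω| ≤ 2 := fun n => by rw [abs_neg]; exact he n ω
  have key : ∀ n, (σ * -pSum Z n ω + -e n ω) / lilNorm n
      = -((σ * pSum Z n ω + e n ω) / lilNorm n) := fun n => by ring
  constructor
  · exact limsup_eq_aux _ _ (path_upper (fun n => pSum Z n ω) (fun n => e n ω) σ hσ (he · ω) h1)
      (path_lower (fun n => pSum Z n ω) (fun n => e n ω) σ hσ (he · ω) h2)
  · apply liminf_eq_aux
    · intro ε hε
      filter_upwards [path_upper (fun n => -pSum Z n ω) (fun n => -e n ω) σ hσ he' h3 ε hε]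
        with n hn
      rw [key] at hn
      linarith
    · intro ε hε
      refine (path_lower (fun n => -pSum Z n ω) (fun n => -e n ω) σ hσ he' h4 ε hε).mono ?_
      intro n hn
      rw [key] at hn
      linarith

lemma tendsto_err (e : ℕ → ℝ) (he : ∀ n, |e n| ≤ 2) (b : ℕ → ℝ) (hb : Tendsto b atTop atTop) :
    Tendsto (fun n => e n / b n) atTop (𝓝 0) := by
  have h1 : Tendsto (fun n => 2 / b n) atTop (𝓝 0) := tendsto_const_nhds.div_atTop hb
  refine squeeze_zero_norm' ?_ h1
  filter_upwards [hb.eventually_gt_atTop 0] with n hn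
  rw [norm_div, Real.norm_of_nonneg hn.le, Real.norm_eq_abs]
  gcongr
  exact he n

lemma StdSeq.slln (h : StdSeq P Z B) (σ m : ℝ) (e : ℕ → Ω → ℝ)
    (he : ∀ n ω, |e n ω| ≤ 2) :
    ∀ᵐ ω ∂P, Tendsto (fun n : ℕ => (n * m + σ * pSum Z n ω + e n ω) / n) atTop (𝓝 m) := by
  have := strong_law_ae_real Z (h.integrable 0) (fun i j hij => h.indep.indepFun hij) h.ident
  filter_upwards [this] with ω hω
  rw [h.mean] at hω
  have h2 := tendsto_err (fun n => e n ω) (he · ω) (fun n : ℕ => (n : ℝ))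
    tendsto_natCast_atTop_atTop
  have h3 := ((hω.const_mul σ).add h2).const_add m
  simp only [mul_zero, add_zero] at h3
  refine h3.congr' ?_
  filter_upwards [eventually_gt_atTop 0] with n hn
  have : (n : ℝ) ≠ 0 := by positivity
  unfold pSum
  field_simp
  ring

lemma StdSeq.clt' (h : StdSeq P Z B) (σ : ℝ) (hσ : 0 < σ) (e : ℕ → Ω → ℝ)
    (hem : ∀ n, Measurable (e n)) (he : ∀ n ω, |e n ω| ≤ 2) :
    TendstoInDist (fun n : ℕ => P.map (fun ω => (σ * pSum Z n ω + e n ω) / (√n * σ)))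
      (gaussianReal 0 1) := by
  have hm : ∀ n : ℕ, Measurable (fun ω => (σ * pSum Z n ω + e n ω) / (√n * σ)) := by
    intro n
    have := hem n
    have := h.measurable_pSum n
    fun_prop
  have hT : TendstoInDistribution (fun (n : ℕ) ω => (σ * pSum Z n ω + e n ω) / (√n * σ)) atTop
      (id : ℝ → ℝ) (fun _ => P) (gaussianReal 0 1) := by
    refine tendstoInDistribution_of_tendstoInMeasure_sub _ _ h.clt ?_ (fun n => (hm n).aemeasurable)
    apply tendstoInMeasure_of_tendsto_ae
    · intro n
      exact ((hm n).sub ((h.measurable_pSum n).const_mul _)).aestronglyMeasurable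
    · refine ae_of_all _ fun ω => ?_
      have h2 := tendsto_err (fun n => e n ω) (he · ω) (fun n : ℕ => √(n : ℝ) * σ)
        ((Real.tendsto_sqrt_atTop.comp tendsto_natCast_atTop_atTop).atTop_mul_const hσ)
      refine h2.congr fun n => ?_
      simp only [Pi.sub_apply]
      rcases Nat.eq_zero_or_pos n with rfl | hn
      · simp
      · have : 0 < √(n : ℝ) := by positivity
        field_simp
        ring
  have h1 := hT.tendsto
  intro f
  have := (ProbabilityMeasure.tendsto_iff_forall_integral_tendsto.1 h1) f
  simpa using this

end Std

lemma std_of_steps {Ω : Type*} [MeasurableSpace Ω] (P : Measure Ω) [IsProbabilityMeasure P]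
    (p q σ : ℝ) (hσ : 0 < σ) (hσ2 : σ ^ 2 = p + q - (p - q) ^ 2) (hp : 0 < p) (hq : 0 < q)
    (hp1 : p < 1) (hq1 : q < 1)
    (Y : ℕ → Ω → ℝ) (hY : ∀ n, Measurable (Y n))
    (hYval : ∀ n ω, Y n ω = 1 ∨ Y n ω = -1 ∨ Y n ω = 0)
    (hlaw : ∀ n A, MeasurableSet A → P.real (Y n ⁻¹' A) = stepProb p q A)
    (hind : iIndepFun Y P) :
    StdSeq P (fun n ω => (Y n ω - (p - q)) / σ) (2 / σ) := by
  have hg : Measurable (fun x : ℝ => (x - (p - q)) / σ) := by fun_prop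
  have m1 : MeasurableSet {ω | Y 0 ω = 1} := hY 0 (measurableSet_singleton 1)
  have m2 : MeasurableSet {ω | Y 0 ω = -1} := hY 0 (measurableSet_singleton (-1))
  have e1 : P.real {ω | Y 0 ω = 1} = p := by
    have := hlaw 0 {1} (measurableSet_singleton 1)
    rw [show Y 0 ⁻¹' {1} = {ω | Y 0 ω = 1} from rfl] at this
    rw [this, stepProb]
    norm_num [Set.indicator]
  have e2 : P.real {ω | Y 0 ω = -1} = q := by
    have := hlaw 0 {-1} (measurableSet_singleton (-1))
    rw [show Y 0 ⁻¹' {-1} = {ω | Y 0 ω = -1} from rfl] at this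
    rw [this, stepProb]
    norm_num [Set.indicator]
  have i1 : Integrable (Set.indicator {ω | Y 0 ω = 1} (fun _ => (1 : ℝ))) P :=
    (integrable_const 1).indicator m1
  have i2 : Integrable (Set.indicator {ω | Y 0 ω = -1} (fun _ => (1 : ℝ))) P :=
    (integrable_const 1).indicator m2
  have I : ∀ F : ℝ → ℝ, ∫ ω, F (Y 0 ω) ∂P = F 0 + (F 1 - F 0) * p + (F (-1) - F 0) * q := by
    intro F
    have : ∀ ω, F (Y 0 ω) = F 0 + (F 1 - F 0) * Set.indicator {ω | Y 0 ω = 1} (fun _ => (1 : ℝ)) ω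
        + (F (-1) - F 0) * Set.indicator {ω | Y 0 ω = -1} (fun _ => (1 : ℝ)) ω := by
      intro ω
      rcases hYval 0 ω with h | h | h <;> norm_num [Set.indicator, h]
    simp_rw [this]
    have i3 : Integrable (fun ω => F 0 +
        (F 1 - F 0) * Set.indicator {ω | Y 0 ω = 1} (fun _ => (1 : ℝ)) ω) P :=
      (integrable_const _).add (i1.const_mul _)
    rw [integral_add i3 (i2.const_mul _),
      integral_add (integrable_const _) (i1.const_mul _), integral_const_mul, integral_const_mul,
      integral_indicator_const _ m1, integral_indicator_const _ m2, e1, e2]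
    simp
  refine ⟨fun n => hg.comp (hY n), hind.comp (fun _ x => (x - (p - q)) / σ) (fun _ => hg), ?_,
    by positivity, ?_, ?_, ?_⟩
  · intro n
    have : IdentDistrib (Y n) (Y 0) P P := by
      refine ⟨(hY n).aemeasurable, (hY 0).aemeasurable, ?_⟩
      ext A hA
      rw [Measure.map_apply (hY n) hA, Measure.map_apply (hY 0) hA]
      have := (hlaw n A hA).trans (hlaw 0 A hA).symm
      exact (measureReal_eq_measureReal_iff).1 this
    exact this.comp hg
  · intro n ω
    rw [abs_div, abs_of_pos hσ]
    gcongr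
    rw [abs_le]
    rcases hYval n ω with h | h | h <;> rw [h] <;> constructor <;> linarith
  · rw [I (fun x => (x - (p - q)) / σ)]
    field_simp
    ring
  · rw [I (fun x => ((x - (p - q)) / σ) ^ 2)]
    field_simp
    rw [hσ2]
    ring

/-- for the ERWD remembering only the first step, started at `X₁ ≡ 1`,
the partial sums `Tₙ` satisfy the SLLN, the CLT and the LIL. -/
theorem erwd_first_step_memory_started_at_one
    {Ω : Type*} [MeasurableSpace Ω] (P : Measure Ω) [IsProbabilityMeasure P]
    (p q r : ℝ) (hp : 0 < p) (hp1 : p < 1) (hq : 0 < q) (hq1 : q < 1)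
    (hr : 0 < r) (hr1 : r < 1) (hpqr : p + q + r = 1)
    (X : ℕ → Ω → ℝ) (hXmeas : ∀ n, Measurable (X n))
    (hXval : ∀ n, 1 ≤ n → ∀ ω, X n ω = 1 ∨ X n ω = -1 ∨ X n ω = 0)
    (hX1 : ∀ ω, X 1 ω = 1)
    (hcondp : ∀ n : ℕ, 1 ≤ n →
      P[Set.indicator {ω | X (n + 1) ω = 1} (fun _ => (1 : ℝ)) | sigmaUpTo X n]
        =ᵐ[P] fun ω =>
          p * (if X 1 ω = 1 then (1 : ℝ) else 0) + q * (if X 1 ω = -1 then (1 : ℝ) else 0))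
    (hcondq : ∀ n : ℕ, 1 ≤ n →
      P[Set.indicator {ω | X (n + 1) ω = -1} (fun _ => (1 : ℝ)) | sigmaUpTo X n]
        =ᵐ[P] fun ω =>
          q * (if X 1 ω = 1 then (1 : ℝ) else 0) + p * (if X 1 ω = -1 then (1 : ℝ) else 0))
    (T : ℕ → Ω → ℝ) (hT : ∀ n ω, T n ω = ∑ k ∈ Finset.Icc 1 n, X k ω) :
    (∀ᵐ ω ∂P, Tendsto (fun n : ℕ => T n ω / n) atTop (𝓝 (p - q))) ∧
    TendstoInDist
      (fun n : ℕ =>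
        Measure.map
          (fun ω => (T n ω - n * (p - q)) / Real.sqrt (n * (p + q - (p - q) ^ 2))) P)
      (gaussianReal 0 1) ∧
    (∀ᵐ ω ∂P,
      Filter.limsup
          (fun n : ℕ => (T n ω - n * (p - q)) / Real.sqrt (2 * n * Real.log (Real.log n)))
          atTop = Real.sqrt (p + q - (p - q) ^ 2) ∧
      Filter.liminf
          (fun n : ℕ => (T n ω - n * (p - q)) / Real.sqrt (2 * n * Real.log (Real.log n)))
          atTop = -Real.sqrt (p + q - (p - q) ^ 2)) := by
  have hvarpos : 0 < p + q - (p - q) ^ 2 := by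
    have : 0 < p * q := by positivity
    nlinarith
  set σ : ℝ := √(p + q - (p - q) ^ 2) with hσdef
  have hσ : 0 < σ := Real.sqrt_pos.2 hvarpos
  have hσ2 : σ ^ 2 = p + q - (p - q) ^ 2 := Real.sq_sqrt hvarpos.le
  have hne : ¬ ((1 : ℝ) = -1) := by norm_num
  simp only [hX1, hne, if_true, if_false, mul_one, mul_zero, add_zero] at hcondp hcondq
  obtain ⟨hlaw, hind⟩ := steps_iIndepFun P p q X hXmeas hXval hcondp hcondq
  have hZ := std_of_steps P p q σ hσ hσ2 hp hq hp1 hq1 (fun n => X (n + 2)) (fun n => hXmeas _)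
    (fun n ω => hXval _ (by omega) ω) hlaw hind
  set Z : ℕ → Ω → ℝ := fun n ω => (X (n + 2) ω - (p - q)) / σ with hZdef
  set e : ℕ → Ω → ℝ := fun n ω => X 1 ω - X (n + 1) ω with hedef
  have he : ∀ n ω, |e n ω| ≤ 2 := by
    intro n ω
    rw [hedef, abs_le]
    simp only [hX1]
    rcases hXval (n + 1) (by omega) ω with h | h | h <;> rw [h] <;> norm_num
  have hem : ∀ n, Measurable (e n) := fun n => (hXmeas 1).sub (hXmeas (n + 1))
  have key : ∀ n ω, T n ω = n * (p - q) + σ * pSum Z n ω + e n ω := by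
    intro n ω
    rw [hT]
    induction n with
    | zero => simp [pSum, hedef]
    | succ n ih =>
      rw [Finset.sum_Icc_succ_top (by omega), ih]
      have h1 : pSum Z (n + 1) ω = pSum Z n ω + Z n ω := Finset.sum_range_succ _ _
      have h2 : σ * Z n ω = X (n + 2) ω - (p - q) := by
        simp only [hZdef]; field_simp
      rw [h1, mul_add, h2]
      simp only [hedef]
      push_cast
      ring
  have key2 : ∀ n ω, T n ω - n * (p - q) = σ * pSum Z n ω + e n ω := by
    intro n ω; rw [key]; ring
  refine ⟨?_, ?_, ?_⟩
  · simp only [key]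
    exact hZ.slln σ (p - q) e he
  · have h1 := hZ.clt' σ hσ e hem he
    have h2 : ∀ n : ℕ, √((n : ℝ) * (p + q - (p - q) ^ 2)) = √(n : ℝ) * σ := fun n => by
      rw [Real.sqrt_mul (Nat.cast_nonneg n)]
    simp only [key2, h2]
    exact h1
  · simp only [key2]
    exact hZ.lil σ hσ e he
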